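/- arXiv:2511.16267 — 4 statements merged into one kernel-verified Lean document; each statement's English description precedes it below -/
import Mathlib

section
/- Let V be a finite-dimensional real vector space equipped with a nondegenerate symmetric bilinear form g of index q ≥ 1, where the index of g is the maximal dimension of a linear subspace of V on which g is negative definite. Let ζ ∈ V be a nonzero null vector (g(ζ,ζ) = 0), and let S be a linear subspace of V such that the orthogonal complement ζ^⊥ = {v ∈ V : g(v,ζ) = 0} decomposes as the direct sum ζ^⊥ = ℝ·ζ ⊕ S. Then the restriction of g to S is nondegenerate and has index q − 1. -/
open LinearMap (BilinForm)

/-- A submodule on which the bilinear form `g` is negative definite. -/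
def IsNegDefOn {R V : Type*} [CommRing R] [PartialOrder R] [AddCommGroup V] [Module R V]
    (g : BilinForm R V) (S : Submodule R V) : Prop :=
  ∀ v ∈ S, v ≠ 0 → g v v < 0

/-- The bilinear form `g` has index `q`: `q` is the maximal dimension of a subspace on
which `g` is negative definite. -/
def HasIndex {R V : Type*} [CommRing R] [PartialOrder R] [AddCommGroup V] [Module R V]
    (g : BilinForm R V) (q : ℕ) : Prop :=
  (∃ S : Submodule R V, IsNegDefOn g S ∧ Module.finrank R S = q) ∧
  ∀ S : Submodule R V, IsNegDefOn g S → Module.finrank R S ≤ q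

/-- The `g`-orthogonal complement of the line spanned by `ζ`. -/
def nullPerp {V : Type*} [AddCommGroup V] [Module ℝ V] (g : BilinForm ℝ V) (ζ : V) :
    Submodule ℝ V :=
  LinearMap.ker (g.flip ζ)

theorem mem_nullPerp {V : Type*} [AddCommGroup V] [Module ℝ V] {g : BilinForm ℝ V} {ζ v : V} :
    v ∈ nullPerp g ζ ↔ g v ζ = 0 :=
  Iff.rfl

theorem nullPerp_eq_orthogonal_span {V : Type*} [AddCommGroup V] [Module ℝ V]
    {g : BilinForm ℝ V} (hsym : g.IsSymm) (ζ : V) :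
    nullPerp g ζ = g.orthogonal (Submodule.span ℝ {ζ}) := by
  ext v
  rw [mem_nullPerp, LinearMap.BilinForm.mem_orthogonal_iff]
  constructor
  · intro h n hn
    obtain ⟨c, rfl⟩ := Submodule.mem_span_singleton.1 hn
    simp [hsym.eq ζ v, h]
  · intro h
    rw [hsym.eq v ζ]
    exact h ζ (Submodule.mem_span_singleton_self ζ)

/-- A negative definite subspace of `V` that does not contain the null vector `ζ`, but is
orthogonal to it, can be enlarged by one dimension to a negative definite subspace. -/
theorem IsNegDefOn.exists_finrank_eq_add_one {V : Type*} [AddCommGroup V] [Module ℝ V]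
    [FiniteDimensional ℝ V] {g : BilinForm ℝ V} (hsym : g.IsSymm) (hnd : g.Nondegenerate)
    {ζ : V} (hnull : g ζ ζ = 0) {T : Submodule ℝ V} (hT : IsNegDefOn g T)
    (hTζ : T ≤ nullPerp g ζ) (hζT : ζ ∉ T) :
    ∃ U : Submodule ℝ V, IsNegDefOn g U ∧ Module.finrank ℝ U = Module.finrank ℝ T + 1 := by
  obtain ⟨u, hu, huζ⟩ : ∃ u ∈ g.orthogonal T, g u ζ ≠ 0 := by
    by_contra! h
    apply hζT
    rw [← LinearMap.BilinForm.orthogonal_orthogonal hnd hsym.isRefl T]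
    exact fun u hu => h u hu
  have hζu : g ζ u = g u ζ := hsym.eq ζ u
  obtain ⟨e, heT, he⟩ : ∃ e, (∀ t ∈ T, g t e = 0) ∧ g e e = -1 := by
    refine ⟨u + ((-1 - g u u) / (2 * g u ζ)) • ζ, fun t ht => ?_, ?_⟩
    · have h₁ : g t u = 0 := hu t ht
      have h₂ : g t ζ = 0 := hTζ ht
      simp [h₁, h₂]
    · simp only [map_add, map_smul, LinearMap.add_apply, LinearMap.smul_apply, smul_eq_mul,
        hζu, hnull]
      field_simp
      ring
  have heT' : e ∉ T := fun h => by linarith [heT e h]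
  have he0 : e ≠ 0 := fun h => heT' (h ▸ T.zero_mem)
  refine ⟨T ⊔ Submodule.span ℝ {e}, fun v hv hv0 => ?_, ?_⟩
  · obtain ⟨t, ht, w, hw, rfl⟩ := Submodule.mem_sup.1 hv
    obtain ⟨c, rfl⟩ := Submodule.mem_span_singleton.1 hw
    have hval : g (t + c • e) (t + c • e) = g t t - c * c := by
      simp only [map_add, map_smul, LinearMap.add_apply, LinearMap.smul_apply, smul_eq_mul,
        hsym.eq e t, heT t ht, he]
      ring
    rw [hval]
    by_cases ht0 : t = 0
    · subst ht0
      have hc : c ≠ 0 := by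
        rintro rfl
        simp at hv0
      have := mul_self_pos.2 hc
      simpa using this
    · linarith [hT t ht ht0, mul_self_nonneg c]
  · have hdis : T ⊓ Submodule.span ℝ {e} = ⊥ :=
      ((Submodule.disjoint_span_singleton' he0).2 heT').eq_bot
    have := Submodule.finrank_sup_add_finrank_inf_eq T (Submodule.span ℝ {e})
    rwa [hdis, finrank_bot, finrank_span_singleton he0, add_zero] at this

/-- if `g` is a nondegenerate symmetric bilinear form of index `q ≥ 1` on a
finite-dimensional real vector space, `ζ` is a nonzero null vector and `S` is a complement of
`ℝ·ζ` inside `ζ^⊥`, then the restriction of `g` to the screen space `S` is nondegenerate of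
index `q - 1`. -/
theorem screen_nondegenerate_index_sub_one
    (V : Type*) [AddCommGroup V] [Module ℝ V] [FiniteDimensional ℝ V]
    (g : BilinForm ℝ V) (hsym : g.IsSymm) (hnd : g.Nondegenerate)
    (q : ℕ) (hq : 1 ≤ q) (hidx : HasIndex g q)
    (ζ : V) (hζ : ζ ≠ 0) (hnull : g ζ ζ = 0)
    (S : Submodule ℝ V)
    (hdisj : Submodule.span ℝ {ζ} ⊓ S = ⊥)
    (hsum : Submodule.span ℝ {ζ} ⊔ S = nullPerp g ζ) :
    (g.restrict S).Nondegenerate ∧ HasIndex (g.restrict S) (q - 1) := by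
  have hperp := nullPerp_eq_orthogonal_span hsym ζ
  have hS : S ≤ nullPerp g ζ := hsum ▸ le_sup_right
  have hζS : ζ ∉ S := fun h => hζ <| by
    rw [← Submodule.mem_bot ℝ, ← hdisj]
    exact ⟨Submodule.mem_span_singleton_self ζ, h⟩
  have hfinS : Module.finrank ℝ (nullPerp g ζ) = Module.finrank ℝ S + 1 := by
    have := Submodule.finrank_sup_add_finrank_inf_eq (Submodule.span ℝ {ζ}) S
    rw [hdisj, hsum, finrank_bot, finrank_span_singleton hζ] at this
    lia
  have hfinV : Module.finrank ℝ V ≤ Module.finrank ℝ (nullPerp g ζ) + 1 := by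
    rw [hperp, LinearMap.BilinForm.finrank_orthogonal hnd, finrank_span_singleton hζ]
    lia
  have hle : ∀ T : Submodule ℝ S, IsNegDefOn (g.restrict S) T →
      Module.finrank ℝ T ≤ q - 1 := by
    intro T hT
    have hTS : T.map S.subtype ≤ S := Submodule.map_subtype_le S T
    have hneg : IsNegDefOn g (T.map S.subtype) := by
      rintro _ ⟨t, ht, rfl⟩ ht0
      exact hT t ht fun h => ht0 (by simp [h])
    obtain ⟨U, hU, hUfin⟩ := hneg.exists_finrank_eq_add_one hsym hnd hnull (hTS.trans hS)
      fun h => hζS (hTS h)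
    have := hidx.2 U hU
    rw [hUfin, Submodule.finrank_map_subtype_eq] at this
    lia
  refine ⟨?_, ?_, hle⟩
  · refine LinearMap.BilinForm.nondegenerate_restrict_of_disjoint_orthogonal g hsym.isRefl ?_
    rw [Submodule.disjoint_def]
    intro s hs hs'
    rw [← Submodule.mem_bot ℝ, ← hdisj]
    refine ⟨?_, hs⟩
    rw [SetLike.mem_coe, ← LinearMap.BilinForm.orthogonal_orthogonal hnd hsym.isRefl
      (Submodule.span ℝ {ζ}), ← hperp, ← hsum]
    intro n hn
    obtain ⟨w, hw, t, ht, rfl⟩ := Submodule.mem_sup.1 hn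
    obtain ⟨c, rfl⟩ := Submodule.mem_span_singleton.1 hw
    have h₁ : g ζ s = 0 := (hsym.eq ζ s).trans (hS hs)
    have h₂ : g t s = 0 := hs' t ht
    simp [h₁, h₂]
  · obtain ⟨W, hW, hWfin⟩ := hidx.1
    set A : Submodule ℝ V := (W ⊓ nullPerp g ζ) ⊔ Submodule.span ℝ {ζ} with hA
    have hζW : ζ ∉ W := fun h => (hW ζ h hζ).ne hnull
    have hneg : IsNegDefOn (g.restrict S) (A.comap S.subtype) := by
      rintro ⟨s, hs⟩ hsA hs0
      obtain ⟨w, ⟨hwW, hwζ⟩, z, hz, hwz⟩ := Submodule.mem_sup.1 (show s ∈ A from hsA)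
      obtain ⟨c, rfl⟩ := Submodule.mem_span_singleton.1 hz
      have hwζ : g w ζ = 0 := hwζ
      have hval : g s s = g w w := by
        simp [← hwz, hsym.eq ζ w, hwζ, hnull]
      change g s s < 0
      rw [hval]
      refine hW w hwW fun hw0 => hs0 ?_
      rw [hw0, zero_add] at hwz
      have : s ∈ Submodule.span ℝ {ζ} ⊓ S := ⟨hwz ▸ hz, hs⟩
      rw [hdisj, Submodule.mem_bot] at this
      exact Subtype.ext this
    refine ⟨_, hneg, (hle _ hneg).antisymm ?_⟩
    have h₁ := Submodule.finrank_sup_add_finrank_inf_eq W (nullPerp g ζ)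
    have h₂ := Submodule.finrank_le (W ⊔ nullPerp g ζ)
    have h₃ := Submodule.finrank_sup_add_finrank_inf_eq (W ⊓ nullPerp g ζ)
      (Submodule.span ℝ {ζ})
    have h₄ : (W ⊓ nullPerp g ζ) ⊓ Submodule.span ℝ {ζ} = ⊥ :=
      (Submodule.disjoint_span_singleton' hζ).2 
        (fun (h : ζ ∈ W ⊓ nullPerp g ζ) => hζW h.1) |>.eq_bot
    rw [h₄, finrank_bot, finrank_span_singleton hζ, ← hA] at h₃
    have h₅ := Submodule.finrank_sup_add_finrank_inf_eq A S
    have h₆ : Module.finrank ℝ (A ⊔ S : Submodule ℝ V) ≤ Module.finrank ℝ (nullPerp g ζ) :=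
      Submodule.finrank_mono
        (sup_le (sup_le inf_le_right (hsum ▸ le_sup_left)) hS)
    have h₇ : Module.finrank ℝ (A.comap S.subtype) =
        Module.finrank ℝ (A ⊓ S : Submodule ℝ V) := by
      rw [← Submodule.finrank_map_subtype_eq, Submodule.map_comap_subtype, inf_comm]
    lia
end

section
/- Suppose ζ, N, W : ℝ → ℝ³ together with constants h, k₁, k₂ form a null helix frame (all frame metric relations and Frenet equations hold with constant curvatures). Then the third derivative of ζ satisfies ζ''' = (h² + 2k₁k₂) · ζ' at every t. -/
/-- The flat semi-Euclidean metric of index 2 on `ℝ³`: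
`g(x,y) = x₀y₀ − x₁y₁ − x₂y₂`. -/
def gm (x y : Fin 3 → ℝ) : ℝ := x 0 * y 0 - x 1 * y 1 - x 2 * y 2

/-- for a null helix frame `{ζ, N, W}` with constant curvatures `h, k₁, k₂`,
the velocity field satisfies `ζ''' = (h² + 2k₁k₂) ζ'`. -/
theorem null_helix_third_deriv
    (ζ N W : ℝ → Fin 3 → ℝ) (h k₁ k₂ : ℝ)
    (hζ : ContDiff ℝ (⊤ : ℕ∞) ζ) (hN : ContDiff ℝ (⊤ : ℕ∞) N) (hW : ContDiff ℝ (⊤ : ℕ∞) W)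
    (hζζ : ∀ t, gm (ζ t) (ζ t) = 0) (hNN : ∀ t, gm (N t) (N t) = 0)
    (hζN : ∀ t, gm (ζ t) (N t) = 1) (hWW : ∀ t, gm (W t) (W t) = -1)
    (hζW : ∀ t, gm (ζ t) (W t) = 0) (hNW : ∀ t, gm (N t) (W t) = 0)
    (hF1 : ∀ t, deriv ζ t = h • ζ t + k₁ • W t)
    (hF2 : ∀ t, deriv N t = -h • N t + k₂ • W t)
    (hF3 : ∀ t, deriv W t = k₂ • ζ t + k₁ • N t) :
    ∀ t, deriv (deriv (deriv ζ)) t = (h ^ 2 + 2 * k₁ * k₂) • deriv ζ t := by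
  have dζ : ∀ t, HasDerivAt ζ (h • ζ t + k₁ • W t) t := fun t =>
    hF1 t ▸ (hζ.differentiable (by simp) t).hasDerivAt
  have dN : ∀ t, HasDerivAt N (-h • N t + k₂ • W t) t := fun t =>
    hF2 t ▸ (hN.differentiable (by simp) t).hasDerivAt
  have dW : ∀ t, HasDerivAt W (k₂ • ζ t + k₁ • N t) t := fun t =>
    hF3 t ▸ (hW.differentiable (by simp) t).hasDerivAt
  have second_deriv : deriv (deriv ζ) =
      fun t => h • (h • ζ t + k₁ • W t) + k₁ • (k₂ • ζ t + k₁ • N t) := by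
    rw [funext hF1]
    exact funext fun t => (((dζ t).const_smul h).add ((dW t).const_smul k₁)).deriv
  intro t
  rw [second_deriv, hF1]
  refine (((((dζ t).const_smul h).add ((dW t).const_smul k₁)).const_smul h).add
    ((((dζ t).const_smul k₂).add ((dN t).const_smul k₁)).const_smul k₁)).deriv.trans ?_
  module
end

section
/- Suppose ζ, N, W : ℝ → ℝ³ together with constants h, k₁, k₂ form a null helix frame. Then at every t the third derivative of ζ satisfies ζ''' = ( −g(ζ',N') + (1/2)·g(W',W') ) · ζ'. -/
/-- for a null helix frame `{ζ, N, W}` with constant curvatures `h, k₁, k₂`,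
the velocity field satisfies `ζ''' = (−g(ζ',N') + (1/2)g(W',W')) ζ'`. -/
theorem null_helix_third_deriv_metric_form
    (ζ N W : ℝ → Fin 3 → ℝ) (h k₁ k₂ : ℝ)
    (hζ : ContDiff ℝ (⊤ : ℕ∞) ζ) (hN : ContDiff ℝ (⊤ : ℕ∞) N) (hW : ContDiff ℝ (⊤ : ℕ∞) W)
    (hζζ : ∀ t, gm (ζ t) (ζ t) = 0) (hNN : ∀ t, gm (N t) (N t) = 0)
    (hζN : ∀ t, gm (ζ t) (N t) = 1) (hWW : ∀ t, gm (W t) (W t) = -1)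
    (hζW : ∀ t, gm (ζ t) (W t) = 0) (hNW : ∀ t, gm (N t) (W t) = 0)
    (hF1 : ∀ t, deriv ζ t = h • ζ t + k₁ • W t)
    (hF2 : ∀ t, deriv N t = -h • N t + k₂ • W t)
    (hF3 : ∀ t, deriv W t = k₂ • ζ t + k₁ • N t) :
    ∀ t, deriv (deriv (deriv ζ)) t =
      (-gm (deriv ζ t) (deriv N t) + (1 / 2) * gm (deriv W t) (deriv W t)) • deriv ζ t := by
  have hdζ : Differentiable ℝ ζ := hζ.differentiable (by simp)
  have hdN : Differentiable ℝ N := hN.differentiable (by simp)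
  have hdW : Differentiable ℝ W := hW.differentiable (by simp)
  have h1 : deriv ζ = fun t => h • ζ t + k₁ • W t := funext hF1
  have h2 : deriv (deriv ζ) =
      fun t => (h ^ 2 + k₁ * k₂) • ζ t + (h * k₁) • W t + (k₁ ^ 2) • N t := by
    funext t
    have key := ((hdζ t).hasDerivAt.const_smul h).add ((hdW t).hasDerivAt.const_smul k₁)
    rw [h1]
    refine key.deriv.trans ?_
    rw [hF1, hF3]
    module
  intro t
  have hd3 : deriv (deriv (deriv ζ)) t = (h ^ 2 + 2 * (k₁ * k₂)) • deriv ζ t := by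
    have key := (((hdζ t).hasDerivAt.const_smul (h ^ 2 + k₁ * k₂)).add
      ((hdW t).hasDerivAt.const_smul (h * k₁))).add ((hdN t).hasDerivAt.const_smul (k₁ ^ 2))
    rw [h2]
    refine key.deriv.trans ?_
    rw [hF1, hF2, hF3]
    module
  have hζN' : gm (deriv ζ t) (deriv N t) = -(h ^ 2) - k₁ * k₂ := by
    have e1 := hζN t
    have e2 := hWW t
    have e3 := hζW t
    have e4 := hNW t
    rw [hF1, hF2]
    simp only [gm, Pi.add_apply, Pi.smul_apply, smul_eq_mul] at *
    linear_combination (-(h ^ 2)) * e1 + k₁ * k₂ * e2 + h * k₂ * e3 - h * k₁ * e4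
  have hWW' : gm (deriv W t) (deriv W t) = 2 * (k₁ * k₂) := by
    have e1 := hζN t
    have e2 := hζζ t
    have e3 := hNN t
    rw [hF3]
    simp only [gm, Pi.add_apply, Pi.smul_apply, smul_eq_mul] at *
    linear_combination 2 * k₁ * k₂ * e1 + k₂ ^ 2 * e2 + k₁ ^ 2 * e3
  rw [hd3, hζN', hWW']
  congr 1
  ring
end

section
/- Let ζ : ℝ → ℝ³ be a smooth map with g(ζ,ζ) = 0 and g(ζ',ζ') < 0 at every t, and suppose ζ''' = c·ζ' for a constant c ∈ ℝ. Then there exist smooth maps N, W : ℝ → ℝ³ and smooth functions h, k₁, k₂ : ℝ → ℝ with k₁ > 0 such that ζ, N, W together with h, k₁, k₂ form a null Frenet frame: at every t, g(ζ,ζ) = 0, g(N,N) = 0, g(ζ,N) = 1, g(W,W) = −1, g(ζ,W) = 0, g(N,W) = 0, and ζ' = hζ + k₁W, N' = −hN + k₂W, W' = k₂ζ + k₁N. -/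
theorem HasDerivAt.gm {x y : ℝ → Fin 3 → ℝ} {x' y' : Fin 3 → ℝ} {t : ℝ}
    (hx : HasDerivAt x x' t) (hy : HasDerivAt y y' t) :
    HasDerivAt (fun s => _root_.gm (x s) (y s)) (_root_.gm x' (y t) + _root_.gm (x t) y') t := by
  have hx := hasDerivAt_pi.1 hx
  have hy := hasDerivAt_pi.1 hy
  refine ((((hx 0).mul (hy 0)).sub ((hx 1).mul (hy 1))).sub ((hx 2).mul (hy 2))).congr_deriv ?_
  simp only [_root_.gm]
  ring

theorem gm_comm (x y : Fin 3 → ℝ) : gm x y = gm y x := by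
  simp only [gm]
  ring

theorem gm_add_left (x y z : Fin 3 → ℝ) : gm (x + y) z = gm x z + gm y z := by
  simp only [gm, Pi.add_apply]
  ring

theorem gm_smul_left (r : ℝ) (x y : Fin 3 → ℝ) : gm (r • x) y = r * gm x y := by
  simp only [gm, Pi.smul_apply, smul_eq_mul]
  ring

theorem gm_add_right (x y z : Fin 3 → ℝ) : gm x (y + z) = gm x y + gm x z := by
  rw [gm_comm, gm_add_left, gm_comm y, gm_comm z]

theorem gm_smul_right (r : ℝ) (x y : Fin 3 → ℝ) : gm x (r • y) = r * gm x y := by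
  rw [gm_comm, gm_smul_left, gm_comm y]

/-- converse part of Theorem 3.1: a smooth null curve whose velocity `ζ`
satisfies `ζ''' = c ζ'` with timelike acceleration (`g(ζ',ζ') < 0`) admits a null Frenet
frame `{ζ, N, W}` with curvature functions `h, k₁, k₂`, `k₁ > 0`. -/
theorem null_curve_admits_frenet_frame
    (ζ : ℝ → Fin 3 → ℝ) (c : ℝ)
    (hζ : ContDiff ℝ (⊤ : ℕ∞) ζ)
    (hnull : ∀ t, gm (ζ t) (ζ t) = 0)
    (hacc : ∀ t, gm (deriv ζ t) (deriv ζ t) < 0)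
    (hODE : ∀ t, deriv (deriv (deriv ζ)) t = c • deriv ζ t) :
    ∃ (N W : ℝ → Fin 3 → ℝ) (h k₁ k₂ : ℝ → ℝ),
      ContDiff ℝ (⊤ : ℕ∞) N ∧ ContDiff ℝ (⊤ : ℕ∞) W ∧
      ContDiff ℝ (⊤ : ℕ∞) h ∧ ContDiff ℝ (⊤ : ℕ∞) k₁ ∧ ContDiff ℝ (⊤ : ℕ∞) k₂ ∧
      (∀ t, 0 < k₁ t) ∧
      (∀ t, gm (ζ t) (ζ t) = 0) ∧ (∀ t, gm (N t) (N t) = 0) ∧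
      (∀ t, gm (ζ t) (N t) = 1) ∧ (∀ t, gm (W t) (W t) = -1) ∧
      (∀ t, gm (ζ t) (W t) = 0) ∧ (∀ t, gm (N t) (W t) = 0) ∧
      (∀ t, deriv ζ t = h t • ζ t + k₁ t • W t) ∧
      (∀ t, deriv N t = -(h t) • N t + k₂ t • W t) ∧
      (∀ t, deriv W t = k₂ t • ζ t + k₁ t • N t) := by
  have hζ₁ : ContDiff ℝ (⊤ : ℕ∞) (deriv ζ) := (contDiff_infty_iff_deriv.1 hζ).2
  have hζ₂ : ContDiff ℝ (⊤ : ℕ∞) (deriv (deriv ζ)) := (contDiff_infty_iff_deriv.1 hζ₁).2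
  have d₀ t : HasDerivAt ζ (deriv ζ t) t :=
    ((contDiff_infty_iff_deriv.1 hζ).1 t).hasDerivAt
  have d₁ t : HasDerivAt (deriv ζ) (deriv (deriv ζ) t) t :=
    ((contDiff_infty_iff_deriv.1 hζ₁).1 t).hasDerivAt
  have d₂ t : HasDerivAt (deriv (deriv ζ)) (c • deriv ζ t) t :=
    hODE t ▸ ((contDiff_infty_iff_deriv.1 hζ₂).1 t).hasDerivAt
  have g₀₁ t : gm (ζ t) (deriv ζ t) = 0 := by
    have h := (d₀ t).gm (d₀ t)
    simp only [hnull] at h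
    have := h.unique (hasDerivAt_const t 0)
    rw [gm_comm (deriv ζ t)] at this
    linarith
  have g₀₂ t : gm (ζ t) (deriv (deriv ζ) t) = -gm (deriv ζ t) (deriv ζ t) := by
    have h := (d₀ t).gm (d₁ t)
    simp only [g₀₁] at h
    have := h.unique (hasDerivAt_const t 0)
    linarith
  have g₁₂ t : gm (deriv ζ t) (deriv (deriv ζ) t) = 0 := by
    have h := (d₀ t).gm (d₂ t)
    simp only [g₀₂, gm_smul_right, g₀₁] at h
    have := h.unique ((d₁ t).gm (d₁ t)).neg
    rw [gm_comm (deriv (deriv ζ) t)] at this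
    linarith
  have g₂₂ t : gm (deriv (deriv ζ) t) (deriv (deriv ζ) t) =
      -(c * gm (deriv ζ t) (deriv ζ t)) := by
    have h := (d₁ t).gm (d₂ t)
    simp only [g₁₂, gm_smul_right] at h
    have := h.unique (hasDerivAt_const t 0)
    linarith
  obtain ⟨k, hk, g₁₁⟩ : ∃ k : ℝ, 0 < k ∧ ∀ t, gm (deriv ζ t) (deriv ζ t) = -k ^ 2 := by
    have hd t := (d₁ t).gm (d₁ t)
    refine ⟨√(-gm (deriv ζ 0) (deriv ζ 0)), Real.sqrt_pos.2 (neg_pos.2 (hacc 0)), fun t => ?_⟩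
    rw [Real.sq_sqrt (neg_pos.2 (hacc 0)).le, neg_neg]
    refine is_const_of_deriv_eq_zero (f := fun s => gm (deriv ζ s) (deriv ζ s))
      (fun s => (hd s).differentiableAt) (fun s => ?_) t 0
    rw [(hd s).deriv, gm_comm (deriv (deriv ζ) s), g₁₂, add_zero]
  have hk₀ := hk.ne'
  refine ⟨fun t => (k ^ 2)⁻¹ • deriv (deriv ζ) t + (-(c / (2 * k ^ 2))) • ζ t,
    fun t => k⁻¹ • deriv ζ t, fun _ => 0, fun _ => k, fun _ => c / (2 * k),
    (hζ₂.const_smul _).add (hζ.const_smul _), hζ₁.const_smul _, contDiff_const, contDiff_const,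
    contDiff_const, fun _ => hk, hnull, fun t => ?_, fun t => ?_, fun t => ?_, fun t => ?_,
    fun t => ?_, fun t => ?_, fun t => ?_, fun t => ?_⟩
  · simp only [gm_add_left, gm_add_right, gm_smul_left, gm_smul_right,
      gm_comm _ (ζ t), hnull, g₀₂, g₂₂, g₁₁]
    field_simp
    ring
  · simp only [gm_add_right, gm_smul_right, hnull, g₀₂, g₁₁]
    field_simp
    ring
  · simp only [gm_smul_left, gm_smul_right, g₁₁]
    field_simp
  · simp only [gm_smul_right, g₀₁, mul_zero]
  · simp only [gm_add_left, gm_smul_left, gm_smul_right, g₀₁,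
      gm_comm (deriv (deriv ζ) t), g₁₂, mul_zero, add_zero]
  · rw [zero_smul, zero_add, smul_inv_smul₀ hk₀]
  · refine (((d₂ t).const_smul (k ^ 2)⁻¹).add
      ((d₀ t).const_smul (-(c / (2 * k ^ 2))))).deriv.trans ?_
    ext i
    simp only [Pi.add_apply, Pi.smul_apply, smul_eq_mul]
    field_simp
    ring
  · refine ((d₁ t).const_smul k⁻¹).deriv.trans ?_
    ext i
    simp only [Pi.add_apply, Pi.smul_apply, smul_eq_mul]
    field_simp
    ring
end
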